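/- Theorem 4 (injectivity form: the SERT determines the ERT): If f₁ and f₂ are admissible Euler curves on [0,T] whose smoothed transforms coincide, i.e. F₁(t) = F₂(t) for all t ∈ [0,T], then f₁(t) = f₂(t) for all t ∈ [0,T). -/

import Mathlib

open MeasureTheory Filter Set Topology

/-- The right derivative of the smoothed transform of a bounded measurable function `f` at a point
where `f` is right continuous. -/
theorem hasDerivWithinAt_smoothedTransform {T : ℝ} {f : ℝ → ℝ}
    (hbdd : ∃ C : ℝ, ∀ t ∈ Icc (0 : ℝ) T, |f t| ≤ C) (hmeas : Measurable f)
    {t : ℝ} (ht : t ∈ Ico (0 : ℝ) T) (hrc : Tendsto f (𝓝[>] t) (𝓝 (f t))) :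
    HasDerivWithinAt (fun s => (∫ τ in (0 : ℝ)..s, f τ) - (s / T) * ∫ τ in (0 : ℝ)..T, f τ)
      (f t - (1 / T) * ∫ τ in (0 : ℝ)..T, f τ) (Ici t) t := by
  obtain ⟨C, hC⟩ := hbdd
  have hint : IntervalIntegrable f volume 0 t := by
    rw [intervalIntegrable_iff_integrableOn_Icc_of_le ht.1]
    refine Measure.integrableOn_of_bounded (M := C) measure_Icc_lt_top.ne
      hmeas.aestronglyMeasurable ?_
    filter_upwards [ae_restrict_mem measurableSet_Icc] with x hx
    exact hC x ⟨hx.1, hx.2.trans ht.2.le⟩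
  exact (intervalIntegral.integral_hasDerivWithinAt_right hint
    hmeas.stronglyMeasurable.stronglyMeasurableAtFilter hrc).sub
    (((hasDerivWithinAt_id t _).div_const T).mul_const _)

/-- Theorem 4 (injectivity form): if two admissible Euler curves on `[0,T]` have the
same smoothed transform, then they agree on `[0,T)`. -/
theorem sert_determines_ert
    (T : ℝ) (hT : 0 < T) (f₁ f₂ : ℝ → ℝ)
    (hbdd₁ : ∃ C : ℝ, ∀ t ∈ Set.Icc (0:ℝ) T, |f₁ t| ≤ C)
    (hmeas₁ : Measurable f₁)
    (hrc₁ : ∀ t ∈ Set.Ico (0:ℝ) T,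
      Filter.Tendsto f₁ (nhdsWithin t (Set.Ioi t)) (nhds (f₁ t)))
    (hzero₁ : ∃ tstar ∈ Set.Ioo (0:ℝ) T, ∀ t ∈ Set.Icc (0:ℝ) tstar, f₁ t = 0)
    (hbdd₂ : ∃ C : ℝ, ∀ t ∈ Set.Icc (0:ℝ) T, |f₂ t| ≤ C)
    (hmeas₂ : Measurable f₂)
    (hrc₂ : ∀ t ∈ Set.Ico (0:ℝ) T,
      Filter.Tendsto f₂ (nhdsWithin t (Set.Ioi t)) (nhds (f₂ t)))
    (hzero₂ : ∃ tstar ∈ Set.Ioo (0:ℝ) T, ∀ t ∈ Set.Icc (0:ℝ) tstar, f₂ t = 0)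
    (hFeq : ∀ t ∈ Set.Icc (0:ℝ) T,
      (∫ τ in (0:ℝ)..t, f₁ τ) - (t / T) * (∫ τ in (0:ℝ)..T, f₁ τ)
        = (∫ τ in (0:ℝ)..t, f₂ τ) - (t / T) * (∫ τ in (0:ℝ)..T, f₂ τ)) :
    ∀ t ∈ Set.Ico (0:ℝ) T, f₁ t = f₂ t := by
  have hderiv : ∀ t ∈ Ico (0 : ℝ) T,
      f₁ t - (1 / T) * (∫ τ in (0 : ℝ)..T, f₁ τ)
        = f₂ t - (1 / T) * ∫ τ in (0 : ℝ)..T, f₂ τ := by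
    intro t ht
    have h₁ := hasDerivWithinAt_smoothedTransform hbdd₁ hmeas₁ ht (hrc₁ t ht)
    have h₂ := hasDerivWithinAt_smoothedTransform hbdd₂ hmeas₂ ht (hrc₂ t ht)
    refine (uniqueDiffWithinAt_Ici t).eq_deriv _ h₁ (h₂.congr_of_eventuallyEq ?_ ?_)
    · filter_upwards [Icc_mem_nhdsGE ht.2] with s hs
      exact hFeq s ⟨ht.1.trans hs.1, hs.2⟩
    · exact hFeq t ⟨ht.1, ht.2.le⟩
  obtain ⟨t₁, ht₁, hz₁⟩ := hzero₁
  obtain ⟨t₂, ht₂, hz₂⟩ := hzero₂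
  have h₀ := hderiv 0 ⟨le_rfl, hT⟩
  rw [hz₁ 0 ⟨le_rfl, ht₁.1.le⟩, hz₂ 0 ⟨le_rfl, ht₂.1.le⟩] at h₀
  intro t ht
  linarith [hderiv t ht]
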